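/- Let φ be a conformal mapping from the unit disk Δ onto a simply connected domain Ω ⊂ ℂ with bounded boundary. For n ≥ 1 let γ_n = {z : |z| = 1 − 2⁻ⁿ}, Γ_n = φ(γ_n), and ℓ_n = Λ¹(Γ_n), and suppose that (ℓ_n) is nondecreasing with ℓ_n → ∞ and ℓ₁ > 0. Set ε_n = 1/ℓ_n − 1/ℓ_{n+1} and ν = Σ_{n≥1} ε_n Λ¹|_{γ_{n+1}}. Then ν is a Carleson measure on Δ (indeed ν(S) ≤ 2h·Σ_n ε_n = 2h/ℓ₁ for every sector S = {re^{iθ} : 1 − h ≤ r < 1, |θ − θ₀| ≤ h}), while Σ_{n≥1} ε_n ℓ_{n+1} = ∞, so the push-forward measure μ = Σ_{n≥1} ε_n Λ¹|_{Γ_{n+1}} assigns infinite mass to Ω ∩ D(w, diam(∂Ω)) for w ∈ ∂Ω and hence is not a Carleson measure on Ω. -/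

import Mathlib

open MeasureTheory Metric Set
open scoped ENNReal NNReal

/-- The open unit disk `Δ` in the complex plane. -/
def unitDisk : Set ℂ := Metric.ball (0 : ℂ) 1

/-- The Carleson "norm" `‖μ‖_* = sup { μ(Ω ∩ D(z,r))/r : z ∈ ∂Ω, 0 < r < diam ∂Ω }`
of a positive Borel measure relative to a domain `Ω`. -/
noncomputable def carlesonNorm (Ω : Set ℂ) (μ : Measure ℂ) : ℝ≥0∞ :=
  ⨆ z ∈ frontier Ω, ⨆ r : ℝ,
    ⨆ (_ : 0 < r ∧ ENNReal.ofReal r < EMetric.diam (frontier Ω)),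
      μ (Ω ∩ Metric.ball z r) / ENNReal.ofReal r

/-- `μ` is a Carleson measure on `Ω`. -/
def IsCarleson (Ω : Set ℂ) (μ : Measure ℂ) : Prop :=
  carlesonNorm Ω μ < ⊤

/-- The push-forward `(φ⁻¹)* ν` of a measure `ν` on `D` under a conformal map `φ` of `D`:
the measure `A ↦ ∫_{φ⁻¹(A)} |φ′| dν`. -/
noncomputable def pushForward (D : Set ℂ) (φ : ℂ → ℂ) (ν : Measure ℂ) : Measure ℂ :=
  Measure.map φ ((ν.restrict D).withDensity fun z => (‖deriv φ z‖₊ : ℝ≥0∞))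

/-- The Carleson sector `S = {re^{iθ} : 1 - h ≤ r < 1, |θ - θ₀| ≤ h}` of the unit disk. -/
def sector (θ₀ h : ℝ) : Set ℂ :=
  {z : ℂ | ∃ r θ : ℝ, 1 - h ≤ r ∧ r < 1 ∧ |θ - θ₀| ≤ h ∧
    z = (r : ℂ) * Complex.exp (θ * Complex.I)}

/-- The measure `ν = Σ_{n ≥ 1} ε_n Λ¹|_{γ_{n+1}}` on the unit disk, where
`ε_n = 1/ℓ_n - 1/ℓ_{n+1}` and `γ_m = {|z| = 1 - 2⁻ᵐ}` (the sum runs over `n ≥ 1`,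
reindexed by `ℕ`). -/
noncomputable def nuMeasure (ℓ : ℕ → ℝ) : Measure ℂ :=
  Measure.sum fun n : ℕ =>
    ENNReal.ofReal (1 / ℓ (n + 1) - 1 / ℓ (n + 2)) •
      μH[1].restrict (Metric.sphere (0 : ℂ) (1 - (1/2 : ℝ) ^ (n + 2)))

/-- The measure `μ = Σ_{n ≥ 1} ε_n Λ¹|_{Γ_{n+1}}` on `Ω`, where `Γ_m = φ(γ_m)`. -/
noncomputable def muMeasure (φ : ℂ → ℂ) (ℓ : ℕ → ℝ) : Measure ℂ :=
  Measure.sum fun n : ℕ =>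
    ENNReal.ofReal (1 / ℓ (n + 1) - 1 / ℓ (n + 2)) •
      μH[1].restrict (φ '' Metric.sphere (0 : ℂ) (1 - (1/2 : ℝ) ^ (n + 2)))

section AreaFormula

/-- A map that expands distances at least by `K⁻¹` on `s` cannot shrink Hausdorff measure much. -/
theorem hausdorffMeasure_le_mul_image {X Y : Type*} [EMetricSpace X] [MeasurableSpace X]
    [BorelSpace X] [EMetricSpace Y] [MeasurableSpace Y] [BorelSpace Y] {f : X → Y} {s : Set X}
    {K : ℝ≥0} (h : ∀ x ∈ s, ∀ y ∈ s, edist x y ≤ K * edist (f x) (f y)) {d : ℝ} (hd : 0 ≤ d) :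
    μH[d] s ≤ (K : ℝ≥0∞) ^ d * μH[d] (f '' s) := by
  rcases s.eq_empty_or_nonempty with rfl | ⟨x₀, -⟩
  · simp
  have : Nonempty X := ⟨x₀⟩
  have hinj : InjOn f s := fun x hx y hy hxy => by
    simpa [hxy] using h x hx y hy
  have hlip : LipschitzOnWith K (Function.invFunOn f s) (f '' s) := by
    rintro _ ⟨x, hx, rfl⟩ _ ⟨y, hy, rfl⟩
    rw [hinj.leftInvOn_invFunOn hx, hinj.leftInvOn_invFunOn hy]
    exact h x hx y hy
  have := hlip.hausdorffMeasure_image_le hd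
  rwa [hinj.leftInvOn_invFunOn.image_image] at this

variable {f f' : ℂ → ℂ}

/-- If `f` is nearly linear on `B` and `f'` nearly constant there, the arclength formula holds
on `B` up to a small error. -/
theorem arclength_approx {B : Set ℂ} (hB : MeasurableSet B) {ε : ℝ≥0} {a : ℂ}
    (hlin : ∀ x ∈ B, ∀ y ∈ B, ‖f x - f y - a * (x - y)‖ ≤ ε * ‖x - y‖)
    (hder : ∀ x ∈ B, ‖f' x - a‖ ≤ ε) :
    μH[1] (f '' B) ≤ (∫⁻ x in B, ‖f' x‖₊ ∂μH[1]) + 2 * ε * μH[1] B ∧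
    (∫⁻ x in B, ‖f' x‖₊ ∂μH[1]) ≤ μH[1] (f '' B) + 2 * ε * μH[1] B := by
  have hnn : ∀ x ∈ B, ‖f' x‖₊ ≤ ‖a‖₊ + ε ∧ ‖a‖₊ ≤ ‖f' x‖₊ + ε := fun x hx => by
    simp only [← NNReal.coe_le_coe, NNReal.coe_add, coe_nnnorm]
    have h1 := hder x hx
    have h2 := norm_sub_norm_le (f' x) a
    have h3 := norm_sub_norm_le a (f' x)
    rw [norm_sub_rev] at h3
    constructor <;> linarith
  constructor
  · have hl : LipschitzOnWith (‖a‖₊ + ε) f B := by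
      refine LipschitzOnWith.of_dist_le_mul fun x hx y hy => ?_
      rw [dist_eq_norm, dist_eq_norm]
      have h1 := hlin x hx y hy
      have h2 := norm_le_insert' (f x - f y) (a * (x - y))
      rw [norm_mul] at h2
      push_cast
      linarith
    have h1 := hl.hausdorffMeasure_image_le zero_le_one
    rw [ENNReal.rpow_one] at h1
    calc μH[1] (f '' B) ≤ ↑(‖a‖₊ + ε) * μH[1] B := h1
      _ = ∫⁻ x in B, (‖a‖₊ + ε : ℝ≥0) ∂μH[1] := by simp
      _ ≤ ∫⁻ x in B, (‖f' x‖₊ + 2 * ε) ∂μH[1] := by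
        refine setLIntegral_mono' hB fun x hx => ?_
        have := (hnn x hx).2
        have h2 : ‖a‖₊ + ε ≤ ‖f' x‖₊ + 2 * ε := by
          rw [two_mul, ← add_assoc]; gcongr
        exact_mod_cast h2
      _ = _ := by
        rw [lintegral_add_right _ measurable_const]; simp
  · have h0 : (∫⁻ x in B, ‖f' x‖₊ ∂μH[1]) ≤ ↑(‖a‖₊ + ε) * μH[1] B := by
      calc _ ≤ ∫⁻ x in B, (‖a‖₊ + ε : ℝ≥0) ∂μH[1] :=
            setLIntegral_mono' hB fun x hx => by exact_mod_cast (hnn x hx).1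
        _ = _ := by simp
    refine h0.trans ?_
    rcases le_or_gt ‖a‖₊ ε with hle | hlt
    · refine le_add_left ?_
      gcongr
      rw [two_mul]
      exact_mod_cast add_le_add_left hle ε
    · have hpos : 0 < ‖a‖₊ - ε := tsub_pos_of_lt hlt
      have h1 := hausdorffMeasure_le_mul_image (f := f) (s := B) (K := (‖a‖₊ - ε)⁻¹) (d := 1)
        (fun x hx y hy => by
          rw [edist_nndist, edist_nndist]
          norm_cast
          rw [← div_eq_inv_mul, le_div_iff₀ hpos, ← NNReal.coe_le_coe]
          push_cast [NNReal.coe_sub hlt.le]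
          rw [dist_eq_norm, dist_eq_norm]
          have h1 := hlin x hx y hy
          have h2 := norm_le_insert (f x - f y) (a * (x - y))
          rw [norm_mul] at h2
          linarith) zero_le_one
      rw [ENNReal.rpow_one] at h1
      have h2 : ((‖a‖₊ - ε : ℝ≥0) : ℝ≥0∞) * μH[1] B ≤ μH[1] (f '' B) := by
        calc _ ≤ ((‖a‖₊ - ε : ℝ≥0) : ℝ≥0∞) * (((‖a‖₊ - ε)⁻¹ : ℝ≥0) * μH[1] (f '' B)) := by gcongr
          _ = _ := by
            rw [← mul_assoc, ← ENNReal.coe_mul, mul_inv_cancel₀ hpos.ne']; simp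
      have h3 : ‖a‖₊ + ε = (‖a‖₊ - ε) + 2 * ε := by
        rw [two_mul, ← add_assoc, tsub_add_cancel_of_le hlt.le]
      rw [h3]
      push_cast [-ENNReal.coe_sub]
      rw [add_mul]
      gcongr

/-- A holomorphic function is nearly linear on small balls. -/
theorem exists_ball_nearly_linear {U : Set ℂ} (hU : IsOpen U) (hf : DifferentiableOn ℂ f U)
    {x : ℂ} (hx : x ∈ U) {ε : ℝ} (hε : 0 < ε) :
    ∃ r > 0, (∀ y ∈ ball x r, ∀ z ∈ ball x r,
      ‖f y - f z - deriv f x * (y - z)‖ ≤ ε * ‖y - z‖) ∧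
      ∀ y ∈ ball x r, ‖deriv f y - deriv f x‖ ≤ ε := by
  have han := hf.analyticAt (hU.mem_nhds hx)
  have h1 := (hasStrictFDerivAt_iff_isLittleO.1
    han.hasStrictDerivAt.hasStrictFDerivAt).bound hε
  have h2 := han.deriv.continuousAt
  obtain ⟨r₁, hr₁, hb₁⟩ := Metric.eventually_nhds_iff_ball.1 h1
  obtain ⟨r₂, hr₂, hb₂⟩ := Metric.continuousAt_iff.1 h2 ε hε
  refine ⟨min r₁ r₂, lt_min hr₁ hr₂, fun y hy z hz => ?_, fun y hy => ?_⟩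
  · have := hb₁ (y, z) (by
      rw [← ball_prod_same]
      exact ⟨ball_subset_ball (min_le_left _ _) hy, ball_subset_ball (min_le_left _ _) hz⟩)
    simpa [mul_comm] using this
  · rw [← dist_eq_norm]
    exact (hb₂ ((mem_ball.1 hy).trans_le (min_le_right _ _))).le

/-- The arclength formula up to a small error. -/
theorem arclength_approx_of_holomorphic {U : Set ℂ} (hU : IsOpen U) (hf : DifferentiableOn ℂ f U)
    (hinj : InjOn f U) {s : Set ℂ} (hs : MeasurableSet s) (hsU : s ⊆ U) {ε : ℝ≥0} (hε : 0 < ε) :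
    μH[1] (f '' s) ≤ (∫⁻ x in s, ‖deriv f x‖₊ ∂μH[1]) + 2 * ε * μH[1] s ∧
    (∫⁻ x in s, ‖deriv f x‖₊ ∂μH[1]) ≤ μH[1] (f '' s) + 2 * ε * μH[1] s := by
  rcases s.eq_empty_or_nonempty with rfl | ⟨x₀, hx₀⟩
  · simp
  choose! r hr hlin hder using fun x (hx : x ∈ U) =>
    exists_ball_nearly_linear hU hf hx (NNReal.coe_pos.2 hε)
  obtain ⟨t, hts, htc, htcov⟩ := TopologicalSpace.countable_cover_nhdsWithin
    (f := fun x => ball x (r x)) (s := s)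
    fun x hx => mem_nhdsWithin_of_mem_nhds (ball_mem_nhds x (hr x (hsU hx)))
  have htne : t.Nonempty := by
    obtain ⟨y, hy, -⟩ := mem_iUnion₂.1 (htcov hx₀)
    exact ⟨y, hy⟩
  obtain ⟨g, rfl⟩ := htc.exists_eq_range htne
  have hgU : ∀ n, g n ∈ U := fun n => hsU (hts (mem_range_self n))
  set B : ℕ → Set ℂ := fun n => s ∩ disjointed (fun n => ball (g n) (r (g n))) n with hBdef
  have hBm : ∀ n, MeasurableSet (B n) := fun n =>
    hs.inter (MeasurableSet.disjointed (fun n => measurableSet_ball) n)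
  have hBd : Pairwise (Function.onFun Disjoint B) := fun i j hij =>
    (disjoint_disjointed _ hij).mono inter_subset_right inter_subset_right
  have hBU : ⋃ n, B n = s := by
    rw [hBdef, ← inter_iUnion, iUnion_disjointed, inter_eq_left]
    simpa using htcov
  have hBb : ∀ n, B n ⊆ ball (g n) (r (g n)) := fun n =>
    inter_subset_right.trans (disjointed_subset _ _)
  have key := fun n => arclength_approx (f := f) (f' := deriv f) (hBm n)
    (fun x hx y hy => hlin _ (hgU n) x (hBb n hx) y (hBb n hy))
    (fun x hx => hder _ (hgU n) x (hBb n hx))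
  have hBsU : ∀ n, B n ⊆ U := fun n => inter_subset_left.trans hsU
  have e1 : μH[1] (f '' s) = ∑' n, μH[1] (f '' B n) := by
    conv_lhs => rw [← hBU, image_iUnion]
    refine measure_iUnion (fun i j hij => ?_) fun n => ?_
    · exact (hBd hij).image hinj (hBsU i) (hBsU j)
    · exact (hBm n).image_of_continuousOn_injOn (hf.continuousOn.mono (hBsU n))
        (hinj.mono (hBsU n))
  have e2 : (∫⁻ x in s, ‖deriv f x‖₊ ∂μH[1]) = ∑' n, ∫⁻ x in B n, ‖deriv f x‖₊ ∂μH[1] := by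
    conv_lhs => rw [← hBU]
    exact lintegral_iUnion hBm hBd _
  have e3 : 2 * ε * μH[1] s = ∑' n, 2 * ε * μH[1] (B n) := by
    conv_lhs => rw [← hBU]
    rw [measure_iUnion hBd hBm, ENNReal.tsum_mul_left]
  rw [e1, e2, e3, ← ENNReal.tsum_add, ← ENNReal.tsum_add]
  exact ⟨ENNReal.tsum_le_tsum fun n => (key n).1, ENNReal.tsum_le_tsum fun n => (key n).2⟩

/-- The arclength formula for injective holomorphic maps. -/
theorem hausdorffMeasure_one_image_eq_lintegral {U : Set ℂ} (hU : IsOpen U)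
    (hf : DifferentiableOn ℂ f U) (hinj : InjOn f U) {s : Set ℂ} (hs : MeasurableSet s)
    (hsU : s ⊆ U) (hfin : μH[1] s ≠ ⊤) :
    μH[1] (f '' s) = ∫⁻ x in s, ‖deriv f x‖₊ ∂μH[1] := by
  have small : ∀ δ : ℝ≥0, 0 < δ → ∃ ε : ℝ≥0, 0 < ε ∧ 2 * ε * μH[1] s ≤ δ := fun δ hδ => by
    lift μH[1] s to ℝ≥0 using hfin with m
    refine ⟨δ / (2 * (m + 1)), by positivity, ?_⟩
    norm_cast
    rw [← NNReal.coe_le_coe]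
    push_cast
    have : (0 : ℝ) ≤ m := m.2
    have : 2 * ((δ : ℝ) / (2 * (m + 1))) * m = δ * (m / (m + 1)) := by field_simp
    rw [this]
    refine mul_le_of_le_one_right δ.2 ?_
    rw [div_le_one (by positivity)]
    linarith
  refine le_antisymm ?_ ?_ <;> refine ENNReal.le_of_forall_pos_le_add fun δ hδ _ => ?_ <;>
    obtain ⟨ε, hε, hle⟩ := small δ hδ
  · exact (arclength_approx_of_holomorphic hU hf hinj hs hsU hε).1.trans (by gcongr)
  · exact (arclength_approx_of_holomorphic hU hf hinj hs hsU hε).2.trans (by gcongr)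

end AreaFormula

section Topology

/-- A preconnected set meeting an open set but not its frontier lies inside the open set. -/
theorem IsPreconnected.subset_of_disjoint_frontier {X : Type*} [TopologicalSpace X] {C Ω : Set X}
    (hC : IsPreconnected C) (hΩ : IsOpen Ω) (hne : (C ∩ Ω).Nonempty)
    (hfr : Disjoint C (frontier Ω)) : C ⊆ Ω := by
  refine hC.subset_left_of_subset_union (v := (closure Ω)ᶜ) hΩ isClosed_closure.isOpen_compl
    (disjoint_compl_right.mono_left subset_closure |>.mono_right le_rfl) (fun x hx => ?_) hne
  by_contra h
  simp only [mem_union, mem_compl_iff, not_or, not_not] at h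
  exact hfr.le_bot ⟨hx, by rw [hΩ.frontier_eq]; exact ⟨h.2, h.1⟩⟩

/-- A bounded open set is contained in the ball around any of its boundary points whose radius is
the diameter of the boundary. -/
theorem subset_ball_diam_frontier {E : Type*} [NormedAddCommGroup E] [NormedSpace ℝ E]
    {Ω : Set E} (hΩ : IsOpen Ω) (hb : Bornology.IsBounded Ω)
    {w : E} (hw : w ∈ frontier Ω) : Ω ⊆ ball w (diam (frontier Ω)) := by
  intro z hz
  have hnot : ∀ x ∈ frontier Ω, x ∉ Ω := fun x hx hxΩ =>
    (disjoint_frontier_iff_isOpen.2 hΩ).le_bot ⟨hx, hxΩ⟩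
  have hzw : 0 < ‖z - w‖ := norm_pos_iff.2 (sub_ne_zero.2 fun h => hnot w hw (h ▸ hz))
  set γ : ℝ → E := fun t => w + t • (z - w) with hγ
  have hdist : ∀ t : ℝ, 1 ≤ t → dist (γ t) w = t * ‖z - w‖ := fun t ht => by
    rw [dist_eq_norm, hγ, add_sub_cancel_left, norm_smul, Real.norm_of_nonneg (by linarith)]
  have hC : IsPreconnected (γ '' Ici 1) :=
    isPreconnected_Ici.image _ (by fun_prop)
  have hmeet : ¬ Disjoint (γ '' Ici 1) (frontier Ω) := fun hdis => by
    have hsub := hC.subset_of_disjoint_frontier hΩ ⟨z, ⟨1, by simp, by simp [hγ]⟩, hz⟩ hdis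
    obtain ⟨R, hR⟩ := (isBounded_iff_subset_ball w).1 hb
    have h1 : (1 : ℝ) ≤ max 1 (R / ‖z - w‖) := le_max_left _ _
    have h2 := hR (hsub ⟨_, h1, rfl⟩)
    rw [mem_ball, hdist _ h1, ← lt_div_iff₀ hzw] at h2
    exact absurd h2 (not_lt.2 (le_max_right _ _))
  obtain ⟨_, ⟨t, ht, rfl⟩, hfr⟩ := Set.not_disjoint_iff.1 hmeet
  have ht1 : 1 < t := lt_of_le_of_ne ht fun h => hnot _ hfr (by simpa [hγ, ← h] using hz)
  have hfb : Bornology.IsBounded (frontier Ω) := hb.closure.subset frontier_subset_closure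
  have h3 := dist_le_diam_of_mem hfb hfr hw
  rw [hdist t ht] at h3
  rw [mem_ball, dist_eq_norm]
  nlinarith

theorem isPreconnected_annulus (ρ : ℝ) (hρ : 0 ≤ ρ) :
    IsPreconnected {z : ℂ | ρ ≤ ‖z‖ ∧ ‖z‖ < 1} := by
  have : {z : ℂ | ρ ≤ ‖z‖ ∧ ‖z‖ < 1} =
      (fun q : ℝ × ℝ => (q.1 : ℂ) * Complex.exp (q.2 * Complex.I)) '' (Ico ρ 1 ×ˢ univ) := by
    ext z
    constructor
    · intro hz
      exact ⟨(‖z‖, z.arg), ⟨hz, trivial⟩, Complex.norm_mul_exp_arg_mul_I z⟩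
    · rintro ⟨⟨r, θ⟩, ⟨⟨h1, h2⟩, -⟩, rfl⟩
      simp only [mem_ofPred_eq, norm_mul, Complex.norm_exp_ofReal_mul_I, mul_one,
        Complex.norm_real, Real.norm_of_nonneg (hρ.trans h1)]
      exact ⟨h1, h2⟩
  rw [this]
  exact (isPreconnected_Ico.prod isPreconnected_univ).image _ (by fun_prop)

/-- An injective holomorphic image of the unit disk with bounded boundary, other than the whole
plane, is bounded. -/
theorem isBounded_image_unitDisk {φ : ℂ → ℂ} {Ω : Set ℂ} (hΩ : IsOpen Ω) (hproper : Ω ≠ univ)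
    (hdiff : DifferentiableOn ℂ φ unitDisk) (hinj : InjOn φ unitDisk) (honto : φ '' unitDisk = Ω)
    (hbd : Bornology.IsBounded (frontier Ω)) : Bornology.IsBounded Ω := by
  by_contra hunb
  obtain ⟨p, hp⟩ := (ne_univ_iff_exists_notMem Ω).1 hproper
  have h0 : (0 : ℂ) ∈ unitDisk := by simp [unitDisk]
  have hmem : ∀ z ∈ unitDisk, φ z ∈ Ω := fun z hz => honto ▸ mem_image_of_mem φ hz
  have hconn : IsPreconnected Ω := by
    rw [← honto]
    exact (convex_ball (0 : ℂ) 1).isPreconnected.image _ hdiff.continuousOn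
  obtain ⟨R₁, hR₁⟩ := (isBounded_iff_subset_ball p).1 hbd
  obtain ⟨R, hR₁R, hR0⟩ : ∃ R, R₁ ≤ R ∧ dist (φ 0) p < R :=
    ⟨max R₁ (dist (φ 0) p + 1), le_max_left _ _, (lt_add_one _).trans_le (le_max_right _ _)⟩
  have hRpos : 0 < R := dist_nonneg.trans_lt hR0
  have hsplit : Disjoint (ball p R) (closedBall p R)ᶜ :=
    disjoint_compl_right.mono_left ball_subset_closedBall
  have hcover : ∀ {C : Set ℂ}, Disjoint C (sphere p R) → C ⊆ ball p R ∪ (closedBall p R)ᶜ := by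
    intro C hC x hx
    have hne : dist x p ≠ R := fun h => hC.le_bot ⟨hx, h⟩
    rcases lt_or_gt_of_ne hne with h | h
    · exact Or.inl h
    · exact Or.inr (by simpa using h)
  have hsphere : sphere p R ⊆ Ω := by
    refine (isPreconnected_sphere (by simp [Complex.rank_real_complex]) p R
      ).subset_of_disjoint_frontier hΩ ?_ ?_
    · by_contra h
      refine hunb (isBounded_ball.subset (hconn.subset_left_of_subset_union isOpen_ball
        isClosed_closedBall.isOpen_compl hsplit (hcover ?_) ⟨φ 0, hmem 0 h0, hR0⟩))
      rw [disjoint_iff_inter_eq_empty, inter_comm]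
      exact not_nonempty_iff_eq_empty.1 h
    · rw [Set.disjoint_left]
      intro x hx hfr
      have h1 := hR₁ hfr
      rw [mem_ball] at h1
      rw [mem_sphere] at hx
      linarith
  have hopen : ∀ s ⊆ unitDisk, IsOpen s → IsOpen (φ '' s) := by
    refine ((hdiff.analyticOnNhd isOpen_ball).is_constant_or_isOpen
      (convex_ball (0 : ℂ) 1).isPreconnected).resolve_left ?_
    rintro ⟨c, hc⟩
    have h2 : (1 / 2 : ℂ) ∈ unitDisk := by simp [unitDisk]; norm_num
    have := hinj h0 h2 ((hc 0 h0).trans (hc _ h2).symm)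
    norm_num at this
  have hsubD : ∀ {ρ : ℝ}, ρ ≤ 1 → ball (0 : ℂ) ρ ⊆ unitDisk := fun h => ball_subset_ball h
  obtain ⟨ρ, hρ0, hρ1, hρ⟩ : ∃ ρ : ℝ, 0 < ρ ∧ ρ < 1 ∧ sphere p R ⊆ φ '' ball 0 ρ := by
    have : Nonempty (Ioo (0 : ℝ) 1) := ⟨⟨1 / 2, by norm_num, by norm_num⟩⟩
    obtain ⟨ρ, hρ⟩ := (isCompact_sphere p R).elim_directed_cover
      (fun ρ : Ioo (0 : ℝ) 1 => φ '' ball 0 ρ)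
      (fun ρ => hopen _ (hsubD ρ.2.2.le) isOpen_ball)
      (fun x hx => by
        obtain ⟨z, hz, rfl⟩ := honto.symm ▸ hsphere hx
        have hz1 : ‖z‖ < 1 := by simpa [unitDisk] using hz
        obtain ⟨ρ, h1, h2⟩ := exists_between hz1
        exact mem_iUnion.2 ⟨⟨ρ, (norm_nonneg z).trans_lt h1, h2⟩, z, by simpa using h1, rfl⟩)
      (Monotone.directed_le fun a b hab => image_mono (ball_subset_ball hab))
    exact ⟨ρ, ρ.2.1, ρ.2.2, hρ⟩
  set A : Set ℂ := {z : ℂ | ρ ≤ ‖z‖ ∧ ‖z‖ < 1}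
  have hAD : A ⊆ unitDisk := fun z hz => by simpa [unitDisk] using hz.2
  have hAconn : IsPreconnected (φ '' A) :=
    (isPreconnected_annulus ρ hρ0.le).image _ (hdiff.continuousOn.mono hAD)
  have hAcov : φ '' A ⊆ ball p R ∪ (closedBall p R)ᶜ := by
    refine hcover (Set.disjoint_left.2 ?_)
    rintro _ ⟨z, hz, rfl⟩ hs
    obtain ⟨y, hy, hyz⟩ := hρ hs
    rw [hinj (hsubD hρ1.le hy) (hAD hz) hyz, mem_ball_zero_iff] at hy
    exact absurd hz.1 (not_le.2 hy)
  have hcl : closure (ball (0 : ℂ) ρ) ⊆ unitDisk := by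
    rw [closure_ball _ hρ0.ne']
    exact closedBall_subset_ball hρ1
  have hfrA : ∀ z ∈ frontier (ball (0 : ℂ) ρ), z ∈ A := fun z hz => by
    rw [frontier_ball _ hρ0.ne', mem_sphere_zero_iff_norm] at hz
    exact ⟨hz.ge, hz ▸ hρ1⟩
  by_cases hin : (φ '' A ∩ ball p R).Nonempty
  · have hsub := hAconn.subset_left_of_subset_union isOpen_ball
      isClosed_closedBall.isOpen_compl hsplit hAcov hin
    have hle : ∀ z ∈ A, ‖φ z - p‖ ≤ R := fun z hz => by
      simpa [dist_eq_norm] using (mem_ball.1 (hsub (mem_image_of_mem φ hz))).le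
    refine hunb ((isBounded_closedBall (x := p) (r := R)).subset ?_)
    rw [← honto]
    rintro _ ⟨z, hz, rfl⟩
    rw [mem_closedBall, dist_eq_norm]
    rcases le_or_gt ρ ‖z‖ with h | h
    · exact hle z ⟨h, by simpa [unitDisk] using hz⟩
    · exact Complex.norm_le_of_forall_mem_frontier_norm_le (f := fun z => φ z - p) isBounded_ball
        ((hdiff.mono hcl).sub_const p).diffContOnCl (fun z hz => hle z (hfrA z hz))
        (subset_closure (by simpa using h))
  · have hout : ∀ z ∈ A, ‖(φ z - p)⁻¹‖ ≤ R⁻¹ := fun z hz => by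
      have h1 : φ z ∉ ball p R := fun h => hin ⟨_, mem_image_of_mem φ hz, h⟩
      rw [mem_ball, dist_eq_norm, not_lt] at h1
      rw [norm_inv]
      exact inv_anti₀ hRpos h1
    have hne : ∀ z ∈ unitDisk, φ z - p ≠ 0 := fun z hz h =>
      hp (sub_eq_zero.1 h ▸ hmem z hz)
    have h1 := Complex.norm_le_of_forall_mem_frontier_norm_le (f := fun z => (φ z - p)⁻¹)
      isBounded_ball
      (((hdiff.mono hcl).sub_const p).inv fun z hz => hne z (hcl hz)).diffContOnCl
      (fun z hz => hout z (hfrA z hz)) (subset_closure (mem_ball_self hρ0))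
    rw [norm_inv, inv_le_inv₀ (norm_pos_iff.2 (hne 0 h0)) hRpos, ← dist_eq_norm] at h1
    exact absurd hR0 (not_lt.2 h1)

end Topology

section NuMeasure

theorem hausdorffMeasure_circleMap_image_Icc_le {ρ : ℝ} (hρ0 : 0 ≤ ρ) (hρ1 : ρ ≤ 1) (a b : ℝ) :
    μH[1] (circleMap 0 ρ '' Icc a b) ≤ ENNReal.ofReal (b - a) := by
  refine ((lipschitzWith_circleMap 0 ρ).hausdorffMeasure_image_le zero_le_one _).trans ?_
  rw [hausdorffMeasure_real, Real.volume_Icc, ENNReal.rpow_one]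
  refine mul_le_of_le_one_left' ?_
  rw [Real.nnabs_of_nonneg hρ0]
  simpa using hρ1

theorem one_sub_half_pow_mem_Ioo (n : ℕ) : 1 - (1 / 2 : ℝ) ^ (n + 2) ∈ Ioo (0 : ℝ) 1 :=
  ⟨sub_pos.2 (pow_lt_one₀ (by norm_num) (by norm_num) (by omega)), by
    have : (0 : ℝ) < (1 / 2) ^ (n + 2) := by positivity
    linarith⟩

variable {ℓ : ℕ → ℝ}

theorem length_pos (hmono : ∀ n : ℕ, 1 ≤ n → ℓ n ≤ ℓ (n + 1)) (hpos : 0 < ℓ 1) (n : ℕ) :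
    0 < ℓ (n + 1) := by
  induction n with
  | zero => exact hpos
  | succ k ih => exact ih.trans_le (hmono _ (by omega))

theorem weight_nonneg (hmono : ∀ n : ℕ, 1 ≤ n → ℓ n ≤ ℓ (n + 1)) (hpos : 0 < ℓ 1) (n : ℕ) :
    0 ≤ 1 / ℓ (n + 1) - 1 / ℓ (n + 2) :=
  sub_nonneg.2 (one_div_le_one_div_of_le (length_pos hmono hpos n) (hmono _ (by omega)))

theorem tsum_weight_le (hmono : ∀ n : ℕ, 1 ≤ n → ℓ n ≤ ℓ (n + 1)) (hpos : 0 < ℓ 1) :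
    ∑' n : ℕ, ENNReal.ofReal (1 / ℓ (n + 1) - 1 / ℓ (n + 2)) ≤ ENNReal.ofReal (1 / ℓ 1) := by
  refine ENNReal.tsum_le_of_sum_range_le fun N => ?_
  rw [← ENNReal.ofReal_sum_of_nonneg fun n _ => weight_nonneg hmono hpos n,
    Finset.sum_range_sub' (fun n => 1 / ℓ (n + 1))]
  refine ENNReal.ofReal_le_ofReal ?_
  have := length_pos hmono hpos N
  simp only [zero_add, sub_le_self_iff]
  positivity

/-- A set meeting each circle `|z| = ρ` in at most an arc of half-angle `h` has `ν`-mass at most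
`2h / ℓ₁`. -/
theorem nuMeasure_le_of_subset_arc (hmono : ∀ n : ℕ, 1 ≤ n → ℓ n ≤ ℓ (n + 1)) (hpos : 0 < ℓ 1)
    {S : Set ℂ} {θ₀ h : ℝ}
    (hS : ∀ ρ ∈ Ioo (0 : ℝ) 1, S ∩ sphere 0 ρ ⊆ circleMap 0 ρ '' Icc (θ₀ - h) (θ₀ + h)) :
    nuMeasure ℓ S ≤ ENNReal.ofReal (2 * h / ℓ 1) := by
  rw [nuMeasure, Measure.sum_apply_of_countable]
  calc _ ≤ ∑' n : ℕ, ENNReal.ofReal (1 / ℓ (n + 1) - 1 / ℓ (n + 2)) * ENNReal.ofReal (2 * h) := by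
        refine ENNReal.tsum_le_tsum fun n => ?_
        rw [Measure.smul_apply, smul_eq_mul, Measure.restrict_apply' isClosed_sphere.measurableSet]
        have hρ := one_sub_half_pow_mem_Ioo n
        gcongr
        exact (measure_mono (hS _ hρ)).trans
          ((hausdorffMeasure_circleMap_image_Icc_le hρ.1.le hρ.2.le _ _).trans_eq
            (congrArg _ (by ring)))
    _ ≤ ENNReal.ofReal (1 / ℓ 1) * ENNReal.ofReal (2 * h) := by
        rw [ENNReal.tsum_mul_right]
        gcongr
        exact tsum_weight_le hmono hpos
    _ = ENNReal.ofReal (2 * h / ℓ 1) := by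
        rw [← ENNReal.ofReal_mul (by positivity)]
        congr 1
        ring

theorem sector_inter_sphere_subset {θ₀ h ρ : ℝ} (hh : h < 1) :
    sector θ₀ h ∩ sphere 0 ρ ⊆ circleMap 0 ρ '' Icc (θ₀ - h) (θ₀ + h) := by
  rintro _ ⟨⟨r, θ, hr, -, hθ, rfl⟩, hs⟩
  rw [mem_sphere_zero_iff_norm, norm_mul, Complex.norm_exp_ofReal_mul_I, mul_one,
    Complex.norm_real, Real.norm_of_nonneg (by linarith)] at hs
  refine ⟨θ, ?_, by rw [circleMap_zero, hs]⟩
  rw [abs_le] at hθ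
  exact ⟨by linarith, by linarith⟩

/-- A point at distance less than `r` from `1` has argument at most `πr`. -/
theorem abs_arg_le_of_norm_sub_one_lt {u : ℂ} (hu : u ≠ 0) {r : ℝ} (h : ‖u - 1‖ < r) :
    |u.arg| ≤ Real.pi * r := by
  have hn : ‖u‖ ≠ 0 := norm_ne_zero_iff.2 hu
  set v : ℂ := (‖u‖⁻¹ : ℝ) • u with hv
  have hv1 : ‖v‖ = 1 := by
    rw [hv, norm_smul, norm_inv, norm_norm, inv_mul_cancel₀ hn]
  have h1 : ‖v - u‖ ≤ ‖u - 1‖ := by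
    have : v - u = (‖u‖⁻¹ - 1 : ℝ) • u := by rw [hv, sub_smul, one_smul]
    rw [this, norm_smul, Real.norm_eq_abs, ← abs_norm u, ← abs_mul, abs_norm, sub_mul,
      inv_mul_cancel₀ hn, one_mul, abs_sub_comm]
    simpa using abs_norm_sub_norm_le u 1
  have h2 : ‖v - 1‖ ≤ 2 * r := by
    have := norm_add_le (v - u) (u - 1)
    rw [sub_add_sub_cancel] at this
    linarith
  have h3 := (Complex.norm_sub_mem_Icc_angle hv1 (norm_one (α := ℂ))).1
  rw [hv, InnerProductGeometry.angle_smul_left_of_pos _ _ (by positivity),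
    Complex.angle_one_right hu, ← hv] at h3
  have hpi := Real.pi_pos
  rw [div_mul_eq_mul_div, div_le_iff₀ hpi] at h3
  nlinarith

theorem ball_inter_sphere_subset {z : ℂ} (hz : ‖z‖ = 1) {r ρ : ℝ} (hρ : 0 < ρ) :
    ball z r ∩ sphere 0 ρ ⊆
      circleMap 0 ρ '' Icc (z.arg - Real.pi * r) (z.arg + Real.pi * r) := by
  rintro w ⟨hw, hs⟩
  rw [mem_sphere_zero_iff_norm] at hs
  have hz0 : z ≠ 0 := norm_ne_zero_iff.1 (by rw [hz]; exact one_ne_zero)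
  have hw0 : w ≠ 0 := norm_ne_zero_iff.1 (by rw [hs]; exact hρ.ne')
  have hu : ‖w / z - 1‖ < r := by
    rw [div_sub_one hz0, norm_div, hz, div_one, ← dist_eq_norm]
    exact hw
  have harg := abs_le.1 (abs_arg_le_of_norm_sub_one_lt (div_ne_zero hw0 hz0) hu)
  refine ⟨z.arg + (w / z).arg, ⟨by linarith, by linarith⟩, ?_⟩
  have e1 := Complex.norm_mul_exp_arg_mul_I (w / z)
  have e2 := Complex.norm_mul_exp_arg_mul_I z
  rw [norm_div, hs, hz, div_one] at e1
  rw [hz, Complex.ofReal_one, one_mul] at e2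
  rw [circleMap_zero, Complex.ofReal_add, add_mul, Complex.exp_add, e2, mul_left_comm, e1,
    mul_div_cancel₀ _ hz0]

theorem isCarleson_nuMeasure (hmono : ∀ n : ℕ, 1 ≤ n → ℓ n ≤ ℓ (n + 1)) (hpos : 0 < ℓ 1) :
    IsCarleson unitDisk (nuMeasure ℓ) := by
  refine lt_of_le_of_lt (b := ENNReal.ofReal (2 * Real.pi / ℓ 1)) ?_ ENNReal.ofReal_lt_top
  refine iSup₂_le fun z hz => iSup_le fun r => iSup_le fun hr => ?_
  rw [unitDisk, frontier_ball _ one_ne_zero, mem_sphere_zero_iff_norm] at hz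
  refine ENNReal.div_le_of_le_mul ?_
  rw [← ENNReal.ofReal_mul (by positivity)]
  convert nuMeasure_le_of_subset_arc (h := Real.pi * r) (S := unitDisk ∩ ball z r)
    (θ₀ := z.arg) hmono hpos
    (fun ρ hρ => (inter_subset_inter_left _ inter_subset_right).trans
      (ball_inter_sphere_subset hz hρ.1)) using 2
  ring

theorem tsum_weight_mul_length_eq_top (hmono : ∀ n : ℕ, 1 ≤ n → ℓ n ≤ ℓ (n + 1))
    (htop : Filter.Tendsto ℓ Filter.atTop Filter.atTop) (hpos : 0 < ℓ 1) :
    ∑' n : ℕ, ENNReal.ofReal ((1 / ℓ (n + 1) - 1 / ℓ (n + 2)) * ℓ (n + 2)) = ⊤ := by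
  have hlen := length_pos hmono hpos
  refine ENNReal.eq_top_of_forall_nnreal_le fun r => ?_
  have hlog := (Real.tendsto_log_atTop.comp htop).comp (Filter.tendsto_add_atTop_nat 1)
  obtain ⟨N, hN⟩ := (hlog.eventually_ge_atTop (r + Real.log (ℓ 1))).exists
  refine le_trans ?_ (ENNReal.sum_le_tsum (Finset.range N))
  rw [← ENNReal.ofReal_sum_of_nonneg fun n _ =>
    mul_nonneg (weight_nonneg hmono hpos n) (hlen (n + 1)).le, ← ENNReal.ofReal_coe_nnreal]
  refine ENNReal.ofReal_le_ofReal ?_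
  calc (r : ℝ) ≤ Real.log (ℓ (N + 1)) - Real.log (ℓ (0 + 1)) := by
        simp only [Function.comp_apply] at hN
        rw [zero_add]
        linarith
    _ = ∑ n ∈ Finset.range N, (Real.log (ℓ (n + 1 + 1)) - Real.log (ℓ (n + 1))) :=
        (Finset.sum_range_sub (fun n => Real.log (ℓ (n + 1))) N).symm
    _ ≤ _ := by
        refine Finset.sum_le_sum fun n _ => ?_
        have h1 := hlen n
        have h2 : 0 < ℓ (n + 2) := hlen (n + 1)
        rw [← Real.log_div h2.ne' h1.ne']
        refine (Real.log_le_sub_one_of_pos (div_pos h2 h1)).trans_eq ?_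
        field_simp

end NuMeasure

section MuMeasure

variable {φ : ℂ → ℂ} {ℓ : ℕ → ℝ}

theorem sphere_subset_unitDisk (n : ℕ) :
    sphere (0 : ℂ) (1 - (1 / 2 : ℝ) ^ (n + 2)) ⊆ unitDisk :=
  sphere_subset_closedBall.trans (closedBall_subset_ball (one_sub_half_pow_mem_Ioo n).2)

theorem hausdorffMeasure_sphere_ne_top (n : ℕ) :
    μH[1] (sphere (0 : ℂ) (1 - (1 / 2 : ℝ) ^ (n + 2))) ≠ ⊤ := by
  have hρ := one_sub_half_pow_mem_Ioo n
  have h := hausdorffMeasure_circleMap_image_Icc_le hρ.1.le hρ.2.le 0 (2 * Real.pi)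
  refine ne_top_of_le_ne_top ENNReal.ofReal_ne_top (le_trans (measure_mono ?_) h)
  rw [← abs_of_pos hρ.1, ← image_circleMap_Ioc, abs_of_pos hρ.1]
  exact image_mono Ioc_subset_Icc_self

theorem sphere_image_subset {Ω : Set ℂ} (honto : φ '' unitDisk = Ω) (n : ℕ) :
    φ '' sphere (0 : ℂ) (1 - (1 / 2 : ℝ) ^ (n + 2)) ⊆ Ω :=
  honto ▸ image_mono (sphere_subset_unitDisk n)

theorem pushForward_nuMeasure (hdiff : DifferentiableOn ℂ φ unitDisk) (hinj : InjOn φ unitDisk) :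
    pushForward unitDisk φ (nuMeasure ℓ) = muMeasure φ ℓ := by
  have hD : MeasurableSet unitDisk := measurableSet_ball
  have hsph : ∀ ρ : ℝ, MeasurableSet (sphere (0 : ℂ) ρ) := fun ρ => isClosed_sphere.measurableSet
  obtain ⟨g, hg, hgφ⟩ : ∃ g : ℂ → ℂ, Measurable g ∧ EqOn g φ unitDisk := by
    classical
    exact ⟨unitDisk.piecewise φ 0, hdiff.continuousOn.measurable_piecewise
      continuous_zero.continuousOn hD, piecewise_eqOn _ _ _⟩
  have hae : φ =ᵐ[((nuMeasure ℓ).restrict unitDisk).withDensity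
      fun z => (‖deriv φ z‖₊ : ℝ≥0∞)] g :=
    (withDensity_absolutelyContinuous _ _).ae_le
      ((ae_restrict_iff' hD).2 (.of_forall fun z hz => (hgφ hz).symm))
  rw [pushForward, Measure.map_congr hae]
  ext A hA
  rw [Measure.map_apply hg hA, withDensity_apply _ (hg hA),
    Measure.restrict_restrict (hg hA), nuMeasure, muMeasure, Measure.sum_apply _ hA,
    Measure.restrict_sum _ ((hg hA).inter hD), lintegral_sum_measure]
  refine tsum_congr fun n => ?_
  set S := sphere (0 : ℂ) (1 - (1 / 2 : ℝ) ^ (n + 2)) with hS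
  have hSD : S ⊆ unitDisk := sphere_subset_unitDisk n
  have hset : φ '' (g ⁻¹' A ∩ unitDisk ∩ S) = A ∩ φ '' S := by
    ext w
    constructor
    · rintro ⟨z, ⟨⟨hzA, hzD⟩, hzS⟩, rfl⟩
      exact ⟨hgφ hzD ▸ hzA, z, hzS, rfl⟩
    · rintro ⟨hwA, z, hzS, rfl⟩
      exact ⟨z, ⟨⟨by rwa [mem_preimage, hgφ (hSD hzS)], hSD hzS⟩, hzS⟩, rfl⟩
  rw [Measure.restrict_smul, lintegral_smul_measure, Measure.smul_apply,
    Measure.restrict_restrict ((hg hA).inter hD), Measure.restrict_apply hA, ← hset,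
    hausdorffMeasure_one_image_eq_lintegral isOpen_ball hdiff hinj
      (((hg hA).inter hD).inter (hsph _)) (inter_subset_right.trans hSD)
      (measure_ne_top_of_subset inter_subset_right (hausdorffMeasure_sphere_ne_top n))]

/-- The measure `μ` has infinite mass on every open set containing `Ω`. -/
theorem muMeasure_eq_top {Ω : Set ℂ} (honto : φ '' unitDisk = Ω)
    (hℓ : ∀ n : ℕ, 1 ≤ n →
      μH[1] (φ '' sphere (0 : ℂ) (1 - (1/2 : ℝ) ^ n)) = ENNReal.ofReal (ℓ n))
    (hmono : ∀ n : ℕ, 1 ≤ n → ℓ n ≤ ℓ (n + 1))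
    (htop : Filter.Tendsto ℓ Filter.atTop Filter.atTop) (hpos : 0 < ℓ 1)
    {V : Set ℂ} (hV : MeasurableSet V) (hΩV : Ω ⊆ V) : muMeasure φ ℓ V = ⊤ := by
  rw [muMeasure, Measure.sum_apply _ hV, ← tsum_weight_mul_length_eq_top hmono htop hpos]
  refine tsum_congr fun n => ?_
  rw [Measure.smul_apply, Measure.restrict_apply hV,
    inter_eq_right.2 ((sphere_image_subset honto n).trans hΩV), hℓ _ (by omega), smul_eq_mul,
    ENNReal.ofReal_mul (weight_nonneg hmono hpos n)]

/-- A Carleson measure has finite mass on each ball whose radius is the diameter of the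
boundary. -/
theorem IsCarleson.measure_ball_diam_lt_top {Ω : Set ℂ} {μ : Measure ℂ} (hμ : IsCarleson Ω μ)
    (hbd : Bornology.IsBounded (frontier Ω)) {w : ℂ} (hw : w ∈ frontier Ω) :
    μ (Ω ∩ ball w (diam (frontier Ω))) < ⊤ := by
  set d := diam (frontier Ω) with hd
  rcases (diam_nonneg (s := frontier Ω)).eq_or_lt with h0 | hdpos
  · simp [hd, ← h0]
  rw [← hd] at hdpos
  refine lt_of_le_of_lt (b := carlesonNorm Ω μ * ENNReal.ofReal d) ?_
    (ENNReal.mul_lt_top hμ ENNReal.ofReal_lt_top)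
  obtain ⟨u, hu, hud, hulim⟩ := exists_seq_strictMono_tendsto' hdpos
  have hcover : Ω ∩ ball w d = ⋃ n, Ω ∩ ball w (u n) := by
    rw [← inter_iUnion]
    congr 1
    ext z
    rw [mem_iUnion]
    constructor
    · intro hz
      exact (hulim.eventually (lt_mem_nhds hz)).exists
    · rintro ⟨n, hn⟩
      exact hn.trans (hud n).2
  have hmonot : Monotone fun n => Ω ∩ ball w (u n) := fun a b hab =>
    inter_subset_inter_right _ (ball_subset_ball (hu.monotone hab))
  rw [hcover, hmonot.measure_iUnion]
  refine iSup_le fun n => ?_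
  have hun := hud n
  have hlt : ENNReal.ofReal (u n) < ediam (frontier Ω) := by
    rw [ENNReal.ofReal_lt_iff_lt_toReal hun.1.le hbd.ediam_ne_top]
    exact hun.2
  have h1 : μ (Ω ∩ ball w (u n)) / ENNReal.ofReal (u n) ≤ carlesonNorm Ω μ :=
    le_iSup₂_of_le w hw (le_iSup_of_le (u n) (le_iSup_of_le ⟨hun.1, hlt⟩ le_rfl))
  rw [ENNReal.div_le_iff (ENNReal.ofReal_pos.2 hun.1).ne' ENNReal.ofReal_ne_top] at h1
  exact h1.trans (by gcongr; exact hun.2.le)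

end MuMeasure

/-- If the lengths `ℓ_n = Λ¹(φ(γ_n))` are nondecreasing and tend to `∞`,
then `ν = Σ ε_n Λ¹|_{γ_{n+1}}` is a Carleson measure on `Δ` (with `ν(S) ≤ 2h/ℓ₁` on every
sector), while `Σ ε_n ℓ_{n+1} = ∞`; hence the push-forward `μ = Σ ε_n Λ¹|_{Γ_{n+1}}` gives
infinite mass to `Ω ∩ D(w, diam ∂Ω)` for `w ∈ ∂Ω` and is not a Carleson measure on `Ω`. -/
theorem stmt_11 (φ : ℂ → ℂ) (Ω : Set ℂ)
    (hΩopen : IsOpen Ω) (hΩne : Ω.Nonempty) (hΩproper : Ω ≠ Set.univ)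
    (hΩconn : IsConnected Ω) (hΩsc : SimplyConnectedSpace Ω)
    (hdiff : DifferentiableOn ℂ φ unitDisk)
    (hinj : Set.InjOn φ unitDisk)
    (honto : φ '' unitDisk = Ω)
    (hbd : Bornology.IsBounded (frontier Ω))
    (ℓ : ℕ → ℝ)
    (hℓ : ∀ n : ℕ, 1 ≤ n →
      μH[1] (φ '' Metric.sphere (0 : ℂ) (1 - (1/2 : ℝ) ^ n)) = ENNReal.ofReal (ℓ n))
    (hmono : ∀ n : ℕ, 1 ≤ n → ℓ n ≤ ℓ (n + 1))
    (htop : Filter.Tendsto ℓ Filter.atTop Filter.atTop)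
    (hpos : 0 < ℓ 1) :
    (∀ θ₀ h : ℝ, 0 < h → h < 1 →
      nuMeasure ℓ (sector θ₀ h) ≤ ENNReal.ofReal (2 * h / ℓ 1)) ∧
    IsCarleson unitDisk (nuMeasure ℓ) ∧
    (∑' n : ℕ, ENNReal.ofReal ((1 / ℓ (n + 1) - 1 / ℓ (n + 2)) * ℓ (n + 2))) = ⊤ ∧
    pushForward unitDisk φ (nuMeasure ℓ) = muMeasure φ ℓ ∧
    (∀ w ∈ frontier Ω,
      muMeasure φ ℓ (Ω ∩ Metric.ball w (Metric.diam (frontier Ω))) = ⊤) ∧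
    ¬ IsCarleson Ω (muMeasure φ ℓ) := by
  have hmass : ∀ w ∈ frontier Ω, muMeasure φ ℓ (Ω ∩ ball w (diam (frontier Ω))) = ⊤ :=
    fun w hw => muMeasure_eq_top honto hℓ hmono htop hpos
      (hΩopen.inter isOpen_ball).measurableSet
      (subset_inter le_rfl (subset_ball_diam_frontier hΩopen
        (isBounded_image_unitDisk hΩopen hΩproper hdiff hinj honto hbd) hw))
  refine ⟨fun θ₀ h _ h1 => nuMeasure_le_of_subset_arc hmono hpos
      fun ρ _ => sector_inter_sphere_subset h1,
    isCarleson_nuMeasure hmono hpos, tsum_weight_mul_length_eq_top hmono htop hpos,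
    pushForward_nuMeasure hdiff hinj, hmass, fun hC => ?_⟩
  obtain ⟨w, hw⟩ := nonempty_frontier_iff.2 ⟨hΩne, hΩproper⟩
  exact (hC.measure_ball_diam_lt_top hbd hw).ne (hmass w hw)
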